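/- arXiv:1403.2634 — 2 statements merged into one kernel-verified Lean document; each statement's English description precedes it below -/
import Mathlib

section
/- Let Γ ≤ Homeo₊(I) be a non-Abelian subgroup with h(Γ) < ∞. Then Γ possesses a maximal inner orbital. -/
open Set

namespace HeightHomeo

/-- The group of orientation-preserving homeomorphisms of a linearly ordered space,
modeled as order-automorphisms (for `I = [0,1]` these are exactly the
orientation-preserving homeomorphisms). -/
instance ordIsoGroup {α : Type*} [Preorder α] : Group (α ≃o α) where
  mul f g := g.trans f
  one := OrderIso.refl α
  inv := OrderIso.symm
  mul_assoc _ _ _ := rfl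
  one_mul _ := rfl
  mul_one _ := rfl
  inv_mul_cancel f := by ext x; exact f.symm_apply_apply x

/-- `Homeo₊(I)`: the group of orientation-preserving homeomorphisms of the closed
unit interval `I = [0,1]`. -/
abbrev HomeoI := unitInterval ≃o unitInterval

/-- The order-convex hull of a set of points of the unit interval. -/
def ordHull (S : Set unitInterval) : Set unitInterval :=
  {y | ∃ a ∈ S, ∃ b ∈ S, a ≤ y ∧ y ≤ b}

/-- `A` is an orbital of the homeomorphism `g`: the convex hull of the orbit of some
point of `I` under the cyclic subgroup `⟨g⟩`, provided it contains more than one point. -/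
def IsOrbitalOf (g : HomeoI) (A : Set unitInterval) : Prop :=
  ∃ x : unitInterval,
    A = ordHull (Set.range fun n : ℤ => (g ^ n) x) ∧ A.Nontrivial

/-- A tower of a subgroup `Γ ≤ Homeo₊(I)`: a set `T` of signed orbitals `(A, g)`
(with `g ∈ Γ` and `A` an orbital of `g`) whose orbitals form a chain under inclusion,
and containing exactly one signed orbital for each of the occurring orbitals. -/
def IsTower (Γ : Subgroup HomeoI) (T : Set (Set unitInterval × HomeoI)) : Prop :=
  (∀ p ∈ T, p.2 ∈ Γ ∧ IsOrbitalOf p.2 p.1) ∧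
  (∀ p ∈ T, ∀ q ∈ T, p.1 ⊆ q.1 ∨ q.1 ⊆ p.1) ∧
  (∀ p ∈ T, ∀ q ∈ T, p.1 = q.1 → p = q)

/-- The left endpoint of a set of points of the unit interval, as a real number. -/
noncomputable def leftEnd (A : Set unitInterval) : ℝ :=
  sInf ((fun x : unitInterval => (x : ℝ)) '' A)

/-- The right endpoint of a set of points of the unit interval, as a real number. -/
noncomputable def rightEnd (A : Set unitInterval) : ℝ :=
  sSup ((fun x : unitInterval => (x : ℝ)) '' A)

/-- Two intervals share an end if they have a common left endpoint or a common right
endpoint. -/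
def ShareEnd (A B : Set unitInterval) : Prop :=
  leftEnd A = leftEnd B ∨ rightEnd A = rightEnd B

/-- A tower is strict if no two distinct orbitals occurring in it share an end. -/
def IsStrictTower (Γ : Subgroup HomeoI) (T : Set (Set unitInterval × HomeoI)) : Prop :=
  IsTower Γ T ∧ ∀ p ∈ T, ∀ q ∈ T, p.1 ≠ q.1 → ¬ ShareEnd p.1 q.1

/-- The set of orbitals occurring in a tower. -/
def towerOrbitals (T : Set (Set unitInterval × HomeoI)) : Set (Set unitInterval) :=
  Prod.fst '' T

/-- The height `h(Γ)` of a subgroup of `Homeo₊(I)`: the supremum (in `ℕ∞`) of the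
cardinalities of the sets of orbitals of its towers. -/
noncomputable def height (Γ : Subgroup HomeoI) : ℕ∞ :=
  ⨆ T ∈ {T | IsTower Γ T}, (towerOrbitals T).encard

/-- The strict height `h_strict(Γ)` of a subgroup of `Homeo₊(I)`: the supremum (in
`ℕ∞`) of the cardinalities of the sets of orbitals of its strict towers. -/
noncomputable def strictHeight (Γ : Subgroup HomeoI) : ℕ∞ :=
  ⨆ T ∈ {T | IsStrictTower Γ T}, (towerOrbitals T).encard

/-- An interval in `I` is inner if it does not share an end with `(0,1)`. -/
def IsInner (A : Set unitInterval) : Prop :=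
  leftEnd A ≠ 0 ∧ rightEnd A ≠ 1

/-- `A` is a maximal inner orbital of `Γ`: an inner orbital of some element of `Γ`
which is not contained in any other inner orbital of (an element of) `Γ`. -/
def IsMaximalInnerOrbital (Γ : Subgroup HomeoI) (A : Set unitInterval) : Prop :=
  (∃ g ∈ Γ, IsOrbitalOf g A) ∧ IsInner A ∧
    ∀ B, (∃ g ∈ Γ, IsOrbitalOf g B) → IsInner B → A ⊆ B → A = B

/-- A group with a bi-invariant total preorder which is Archimedean is commutative up to the
equivalence relation of the preorder (Hölder). -/
theorem mul_le_mul_swap_of_archimedean {G : Type*} [Group G] [Preorder G] [MulLeftMono G]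
    [MulRightMono G] (total : ∀ a b : G, a ≤ b ∨ b ≤ a)
    (arch : ∀ g : G, 1 < g → ∀ h : G, ∃ n : ℤ, h < g ^ n) (a b : G) : a * b ≤ b * a := by
  have : MulLeftStrictMono G := ⟨fun f g h hgh =>
    lt_of_le_not_ge (mul_le_mul_right hgh.le f) fun hle =>
      hgh.not_ge (le_of_mul_le_mul_left' hle)⟩
  have : MulRightStrictMono G := ⟨fun f g h hgh =>
    lt_of_le_not_ge (mul_le_mul_left hgh.le f) fun hle =>
      hgh.not_ge (le_of_mul_le_mul_right' hle)⟩
  have not_le' : ∀ {u v : G}, ¬ u ≤ v → v < u := fun {u v} h =>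
    lt_of_le_not_ge ((total u v).resolve_left h) h
  have mono : ∀ d : G, 1 < d → Monotone fun n : ℤ => d ^ n := fun d hd =>
    monotone_int_of_le_succ fun n => by
      rw [zpow_add_one]; exact le_mul_of_one_le_right' hd.le
  have floor : ∀ d : G, 1 < d → ∀ h : G, ∃ n : ℤ, d ^ n ≤ h ∧ h < d ^ (n + 1) := by
    intro d hd h
    obtain ⟨N, hN⟩ := arch d hd h
    obtain ⟨M, hM⟩ := arch d hd h⁻¹
    obtain ⟨n, hn, hmax⟩ := Int.exists_greatest_of_bdd (P := fun n => d ^ n ≤ h)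
      ⟨N, fun z hz => by
        by_contra! hlt
        exact (hN.trans_le (mono d hd hlt.le)).not_ge hz⟩
      ⟨-M, by rw [zpow_neg]; exact inv_le_of_inv_le' hM.le⟩
    refine ⟨n, hn, not_le' fun hle => ?_⟩
    have := hmax _ hle
    omega
  by_contra hab
  have hlt : b * a < a * b := not_le' hab
  set c := (b * a)⁻¹ * (a * b) with hc
  have hbac : b * a * c = a * b := by rw [hc]; group
  have hc1 : 1 < c := by
    rw [hc]; exact lt_inv_mul_iff_mul_lt.2 (by simpa using hlt)
  by_cases hsq : ∃ d : G, 1 < d ∧ d * d ≤ c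
  · obtain ⟨d, hd, hdc⟩ := hsq
    obtain ⟨m, hm, hm'⟩ := floor d hd a
    obtain ⟨n, hn, hn'⟩ := floor d hd b
    have h1 : a * b < d ^ (m + 1) * d ^ (n + 1) := mul_lt_mul_of_lt_of_le hm' hn'.le
    have h2 : d ^ n * d ^ m * (d * d) ≤ b * a * c := mul_le_mul' (mul_le_mul' hn hm) hdc
    have h3 : d ^ (m + 1) * d ^ (n + 1) = d ^ n * d ^ m * (d * d) := by
      rw [← zpow_add, ← zpow_add, ← zpow_two, ← zpow_add]; congr 1; ring
    rw [hbac, ← h3] at h2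
    exact h1.not_ge h2
  · push Not at hsq
    have least : ∀ e : G, 1 < e → ¬ e < c := by
      intro e he hec
      have hf : 1 < e⁻¹ * c := lt_inv_mul_iff_mul_lt.2 (by simpa using hec)
      have h1 : ¬ e * e ≤ c := hsq e he
      have h2 : ¬ e⁻¹ * c * (e⁻¹ * c) ≤ c := hsq _ hf
      have h3 : e * (e⁻¹ * c) = c := by group
      rcases total e (e⁻¹ * c) with h | h
      · exact h1 (by calc e * e ≤ e * (e⁻¹ * c) := mul_le_mul_right h e
                       _ = c := h3)
      · exact h2 (by calc e⁻¹ * c * (e⁻¹ * c) ≤ e * (e⁻¹ * c) := mul_le_mul_left h _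
                       _ = c := h3)
    have approx : ∀ u : G, ∃ n : ℤ, c ^ n ≤ u ∧ u ≤ c ^ n := by
      intro u
      obtain ⟨n, hn, hn'⟩ := floor c hc1 u
      refine ⟨n, hn, by_contra fun h => ?_⟩
      have h1 : 1 < (c ^ n)⁻¹ * u := lt_inv_mul_iff_mul_lt.2 (by simpa using not_le' h)
      exact least _ h1 (inv_mul_lt_iff_lt_mul.2 (by rwa [← zpow_add_one]))
    obtain ⟨m, hm, hm'⟩ := approx a
    obtain ⟨n, hn, hn'⟩ := approx b
    refine hab ((mul_le_mul' hm' hn').trans ?_)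
    rw [← zpow_add, add_comm, zpow_add]
    exact mul_le_mul' hn hm

theorem mul_apply (g h : HomeoI) (x : unitInterval) : (g * h) x = g (h x) := rfl

theorem one_apply (x : unitInterval) : (1 : HomeoI) x = x := rfl

theorem inv_apply_self (g : HomeoI) (x : unitInterval) : g⁻¹ (g x) = x := g.symm_apply_apply x

theorem apply_inv_self (g : HomeoI) (x : unitInterval) : g (g⁻¹ x) = x := g.apply_symm_apply x

theorem zpow_add_apply (g : HomeoI) (m n : ℤ) (x : unitInterval) :
    (g ^ (m + n)) x = (g ^ m) ((g ^ n) x) := by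
  rw [zpow_add, mul_apply]

theorem zpow_neg_apply_le_iff (g : HomeoI) (n : ℤ) (x y : unitInterval) :
    (g ^ (-n)) x ≤ y ↔ x ≤ (g ^ n) y := by
  rw [← (g ^ n).le_iff_le, ← zpow_add_apply, add_neg_cancel, zpow_zero, one_apply]

theorem le_zpow_neg_apply_iff (g : HomeoI) (n : ℤ) (x y : unitInterval) :
    y ≤ (g ^ (-n)) x ↔ (g ^ n) y ≤ x := by
  rw [← (g ^ n).le_iff_le, ← zpow_add_apply, add_neg_cancel, zpow_zero, one_apply]

theorem zpow_apply_eq_self {g : HomeoI} {x : unitInterval} (h : g x = x) (n : ℤ) :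
    (g ^ n) x = x := by
  induction n using Int.induction_on with
  | zero => rw [zpow_zero, one_apply]
  | succ k ih => rw [zpow_add_one, mul_apply, h, ih]
  | pred k ih =>
    rw [zpow_sub_one, mul_apply]
    nth_rewrite 1 [← h]
    rw [inv_apply_self, ih]

/-- The convex hull of the orbit of `x` under `⟨g⟩`. -/
def orbitHull (g : HomeoI) (x : unitInterval) : Set unitInterval :=
  ordHull (Set.range fun n : ℤ => (g ^ n) x)

theorem mem_orbitHull {g : HomeoI} {x y : unitInterval} :
    y ∈ orbitHull g x ↔ ∃ m n : ℤ, (g ^ m) x ≤ y ∧ y ≤ (g ^ n) x := by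
  simp [orbitHull, ordHull]

theorem self_mem_orbitHull (g : HomeoI) (x : unitInterval) : x ∈ orbitHull g x :=
  mem_orbitHull.2 ⟨0, 0, by simp [one_apply], by simp [one_apply]⟩

theorem mem_orbitHull_symm {g : HomeoI} {x y : unitInterval} (h : y ∈ orbitHull g x) :
    x ∈ orbitHull g y := by
  obtain ⟨m, n, hm, hn⟩ := mem_orbitHull.1 h
  exact mem_orbitHull.2 ⟨-n, -m, (zpow_neg_apply_le_iff ..).2 hn, (le_zpow_neg_apply_iff ..).2 hm⟩

theorem orbitHull_subset {g : HomeoI} {x y : unitInterval} (h : y ∈ orbitHull g x) :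
    orbitHull g y ⊆ orbitHull g x := by
  intro z hz
  obtain ⟨m, n, hm, hn⟩ := mem_orbitHull.1 h
  obtain ⟨k, l, hk, hl⟩ := mem_orbitHull.1 hz
  refine mem_orbitHull.2 ⟨k + m, l + n, ?_, ?_⟩
  · rw [zpow_add_apply]; exact ((g ^ k).monotone hm).trans hk
  · rw [zpow_add_apply]; exact hl.trans ((g ^ l).monotone hn)

theorem orbitHull_eq_of_mem {g : HomeoI} {x y : unitInterval} (h : y ∈ orbitHull g x) :
    orbitHull g y = orbitHull g x :=
  (orbitHull_subset h).antisymm (orbitHull_subset (mem_orbitHull_symm h))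

theorem IsOrbitalOf.eq_orbitHull {g : HomeoI} {A : Set unitInterval} (hA : IsOrbitalOf g A)
    {y : unitInterval} (hy : y ∈ A) : A = orbitHull g y := by
  obtain ⟨x, rfl, -⟩ := hA
  exact (orbitHull_eq_of_mem hy).symm

theorem IsOrbitalOf.nonempty {g : HomeoI} {A : Set unitInterval} (hA : IsOrbitalOf g A) :
    A.Nonempty := by
  obtain ⟨x, -, h⟩ := hA
  exact h.nonempty

theorem IsOrbitalOf.ordConnected {g : HomeoI} {A : Set unitInterval} (hA : IsOrbitalOf g A) :
    A.OrdConnected := by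
  obtain ⟨x, rfl, -⟩ := hA
  refine ⟨fun y ⟨a, ha, _, _, hay, _⟩ z ⟨_, _, b, hb, _, hzb⟩ w hw => ?_⟩
  exact ⟨a, ha, b, hb, hay.trans hw.1, hw.2.trans hzb⟩

theorem IsOrbitalOf.apply_ne {g : HomeoI} {A : Set unitInterval} (hA : IsOrbitalOf g A)
    {y : unitInterval} (hy : y ∈ A) : g y ≠ y := by
  intro h
  have hnt : A.Nontrivial := hA.choose_spec.2
  rw [hA.eq_orbitHull hy] at hnt
  refine hnt.not_subset_singleton (x := y) fun z hz => ?_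
  obtain ⟨m, n, hm, hn⟩ := mem_orbitHull.1 hz
  rw [zpow_apply_eq_self h] at hm hn
  exact le_antisymm hn hm

theorem isOrbitalOf_orbitHull {g : HomeoI} {x : unitInterval} (h : g x ≠ x) :
    IsOrbitalOf g (orbitHull g x) :=
  ⟨x, rfl, g x, mem_orbitHull.2 ⟨1, 1, by simp, by simp⟩, x, self_mem_orbitHull g x, h⟩

theorem IsOrbitalOf.image {h : HomeoI} {A : Set unitInterval} (hA : IsOrbitalOf h A)
    (g : HomeoI) : IsOrbitalOf (g * h * g⁻¹) (g '' A) := by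
  obtain ⟨x, hx, hnt⟩ := hA
  refine ⟨g x, ?_, hnt.image g.injective⟩
  have key : ∀ n : ℤ, ((g * h * g⁻¹) ^ n) (g x) = g ((h ^ n) x) := fun n => by
    rw [conj_zpow, mul_apply, mul_apply, inv_apply_self]
  change _ = orbitHull _ _
  change A = orbitHull _ _ at hx
  ext y
  rw [mem_orbitHull, hx]
  simp_rw [key]
  constructor
  · rintro ⟨z, hz, rfl⟩
    obtain ⟨m, n, hm, hn⟩ := mem_orbitHull.1 hz
    exact ⟨m, n, g.monotone hm, g.monotone hn⟩
  · rintro ⟨m, n, hm, hn⟩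
    refine ⟨g⁻¹ y, mem_orbitHull.2 ⟨m, n, ?_, ?_⟩, apply_inv_self g y⟩
    · rwa [← g.le_iff_le, apply_inv_self]
    · rwa [← g.le_iff_le, apply_inv_self]

/-- `A` is an orbital of some element of `Γ`. -/
def IsOrbital (Γ : Subgroup HomeoI) (A : Set unitInterval) : Prop :=
  ∃ g ∈ Γ, IsOrbitalOf g A

theorem IsOrbital.image {Γ : Subgroup HomeoI} {A : Set unitInterval} (hA : IsOrbital Γ A)
    {g : HomeoI} (hg : g ∈ Γ) : IsOrbital Γ (g '' A) := by
  obtain ⟨h, hh, hA⟩ := hA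
  exact ⟨_, Γ.mul_mem (Γ.mul_mem hg hh) (Γ.inv_mem hg), hA.image g⟩

/-- An infinite sequence of distinct, pairwise comparable orbitals forces infinite height. -/
theorem height_eq_top_of_chain {Γ : Subgroup HomeoI} (f : ℕ → Set unitInterval)
    (hf : ∀ n, IsOrbital Γ (f n)) (inj : Function.Injective f)
    (chain : ∀ m n, f m ⊆ f n ∨ f n ⊆ f m) : height Γ = ⊤ := by
  choose g hg hfg using hf
  let T : Set (Set unitInterval × HomeoI) := Set.range fun n => (f n, g n)
  have hT : IsTower Γ T := by
    refine ⟨?_, ?_, ?_⟩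
    · rintro _ ⟨n, rfl⟩; exact ⟨hg n, hfg n⟩
    · rintro _ ⟨m, rfl⟩ _ ⟨n, rfl⟩; exact chain m n
    · rintro _ ⟨m, rfl⟩ _ ⟨n, rfl⟩ h
      obtain rfl : m = n := inj h
      rfl
  have hcard : (towerOrbitals T).encard = ⊤ := by
    have : towerOrbitals T = Set.range f := by
      simp only [towerOrbitals, T, ← Set.range_comp]
      rfl
    rw [this]
    exact (Set.infinite_range_of_injective inj).encard_eq
  rw [eq_top_iff, ← hcard]
  exact le_iSup₂ (f := fun T (_ : T ∈ {T | IsTower Γ T}) => (towerOrbitals T).encard) T hT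

theorem pow_image_succ (g : HomeoI) (A : Set unitInterval) (n : ℕ) :
    (g ^ (n + 1)) '' A = (g ^ n) '' (g '' A) := by
  rw [pow_succ, ← Set.image_comp]; rfl

theorem height_eq_top_of_image_ssubset {Γ : Subgroup HomeoI} {A : Set unitInterval}
    (hA : IsOrbital Γ A) {g : HomeoI} (hg : g ∈ Γ) (h : g '' A ⊂ A) : height Γ = ⊤ := by
  have anti : StrictAnti fun n : ℕ => (g ^ n) '' A := strictAnti_nat_of_succ_lt fun n => by
    rw [pow_image_succ]
    exact (g ^ n).injective.image_strictMono h
  exact height_eq_top_of_chain _ (fun n => hA.image (Γ.pow_mem hg n)) anti.injective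
    fun m n => (le_total n m).imp (fun h => anti.antitone h) (fun h => anti.antitone h)

theorem image_eq_of_comparable {Γ : Subgroup HomeoI} (hh : height Γ ≠ ⊤)
    {A : Set unitInterval} (hA : IsOrbital Γ A) {g : HomeoI} (hg : g ∈ Γ)
    (h : g '' A ⊆ A ∨ A ⊆ g '' A) : g '' A = A := by
  by_contra hne
  rcases h with h | h
  · exact hh (height_eq_top_of_image_ssubset hA hg (h.ssubset_of_ne hne))
  · refine hh (height_eq_top_of_image_ssubset hA (Γ.inv_mem hg) ?_)
    have hi : (g⁻¹ : HomeoI) '' (g '' A) = A := by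
      rw [← Set.image_comp]
      convert Set.image_id A
      exact inv_apply_self g _
    have := (g⁻¹ : HomeoI).injective.image_strictMono (h.ssubset_of_ne (Ne.symm hne))
    rwa [hi] at this

theorem exists_lt_of_leftEnd_eq_zero {A : Set unitInterval} (hne : A.Nonempty)
    (h : leftEnd A = 0) {e : unitInterval} (he : 0 < e) : ∃ a ∈ A, a < e := by
  have : leftEnd A < e := by rw [h]; exact_mod_cast he
  obtain ⟨_, ⟨a, ha, rfl⟩, hlt⟩ := exists_lt_of_csInf_lt (hne.image _) this
  exact ⟨a, ha, hlt⟩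

theorem exists_gt_of_rightEnd_eq_one {A : Set unitInterval} (hne : A.Nonempty)
    (h : rightEnd A = 1) {e : unitInterval} (he : e < 1) : ∃ a ∈ A, e < a := by
  have : (e : ℝ) < rightEnd A := by rw [h]; exact_mod_cast he
  obtain ⟨_, ⟨a, ha, rfl⟩, hlt⟩ := exists_lt_of_lt_csSup (hne.image _) this
  exact ⟨a, ha, hlt⟩

theorem subset_or_subset_of_exists_lt {α : Type*} [LinearOrder α] {A B : Set α}
    (hA : A.OrdConnected) (hB : B.OrdConnected) (hAB : ∀ b ∈ B, ∃ a ∈ A, a < b)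
    (hBA : ∀ a ∈ A, ∃ b ∈ B, b < a) : A ⊆ B ∨ B ⊆ A := by
  by_contra! h
  obtain ⟨⟨a, ha, haB⟩, ⟨b, hb, hbA⟩⟩ := h.imp Set.not_subset.1 Set.not_subset.1
  rcases le_total a b with hab | hab
  · obtain ⟨b', hb', hlt⟩ := hBA a ha
    exact haB (hB.out hb' hb ⟨hlt.le, hab⟩)
  · obtain ⟨a', ha', hlt⟩ := hAB b hb
    exact hbA (hA.out ha' ha ⟨hlt.le, hab⟩)

theorem subset_or_subset_of_exists_gt {α : Type*} [LinearOrder α] {A B : Set α}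
    (hA : A.OrdConnected) (hB : B.OrdConnected) (hAB : ∀ b ∈ B, ∃ a ∈ A, b < a)
    (hBA : ∀ a ∈ A, ∃ b ∈ B, a < b) : A ⊆ B ∨ B ⊆ A := by
  by_contra! h
  obtain ⟨⟨a, ha, haB⟩, ⟨b, hb, hbA⟩⟩ := h.imp Set.not_subset.1 Set.not_subset.1
  rcases le_total a b with hab | hab
  · obtain ⟨a', ha', hlt⟩ := hAB b hb
    exact hbA (hA.out ha ha' ⟨hab, hlt.le⟩)
  · obtain ⟨b', hb', hlt⟩ := hBA a ha
    exact haB (hB.out hb hb' ⟨hab, hlt.le⟩)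

theorem IsOrbital.pos {Γ : Subgroup HomeoI} {A : Set unitInterval} (hA : IsOrbital Γ A)
    {x : unitInterval} (hx : x ∈ A) : 0 < x := by
  obtain ⟨g, -, hA⟩ := hA
  refine pos_iff_ne_zero.2 ?_
  rintro rfl
  exact hA.apply_ne hx g.map_bot

theorem IsOrbital.lt_one {Γ : Subgroup HomeoI} {A : Set unitInterval} (hA : IsOrbital Γ A)
    {x : unitInterval} (hx : x ∈ A) : x < 1 := by
  obtain ⟨g, -, hA⟩ := hA
  refine lt_of_le_of_ne unitInterval.le_one' ?_
  rintro rfl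
  exact hA.apply_ne hx g.map_top

theorem image_subset_or_subset_of_not_isInner {Γ : Subgroup HomeoI} {A : Set unitInterval}
    (hA : IsOrbital Γ A) (hin : ¬ IsInner A) {g : HomeoI} (hg : g ∈ Γ) :
    g '' A ⊆ A ∨ A ⊆ g '' A := by
  have hne : A.Nonempty := hA.choose_spec.2.nonempty
  have hB := hA.image hg
  have hAc : A.OrdConnected := hA.choose_spec.2.ordConnected
  have hBc : (g '' A).OrdConnected := hB.choose_spec.2.ordConnected
  rw [IsInner, not_and_or, not_not, not_not] at hin
  rcases hin with h | h
  · refine subset_or_subset_of_exists_lt hBc hAc (fun a ha => ?_)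
      fun b hb => exists_lt_of_leftEnd_eq_zero hne h (hB.pos hb)
    have hpos : 0 < g⁻¹ a := by
      have := g⁻¹.strictMono (hA.pos ha)
      rwa [show g⁻¹ 0 = 0 from g⁻¹.map_bot] at this
    obtain ⟨a', ha', hlt⟩ := exists_lt_of_leftEnd_eq_zero hne h hpos
    refine ⟨g a', ⟨a', ha', rfl⟩, ?_⟩
    have := g.strictMono hlt
    rwa [apply_inv_self] at this
  · refine subset_or_subset_of_exists_gt hBc hAc (fun a ha => ?_)
      fun b hb => exists_gt_of_rightEnd_eq_one hne h (hB.lt_one hb)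
    have hlt1 : g⁻¹ a < 1 := by
      have := g⁻¹.strictMono (hA.lt_one ha)
      rwa [show g⁻¹ 1 = 1 from g⁻¹.map_top] at this
    obtain ⟨a', ha', hlt⟩ := exists_gt_of_rightEnd_eq_one hne h hlt1
    refine ⟨g a', ⟨a', ha', rfl⟩, ?_⟩
    have := g.strictMono hlt
    rwa [apply_inv_self] at this

/-- If every orbital of `Γ` is `Γ`-invariant then distinct orbitals are disjoint. -/
theorem IsOrbital.eq_of_mem {Γ : Subgroup HomeoI}
    (inv : ∀ A, IsOrbital Γ A → ∀ g ∈ Γ, g '' A = A) {A B : Set unitInterval}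
    (hA : IsOrbital Γ A) (hB : IsOrbital Γ B) {x : unitInterval} (hxA : x ∈ A) (hxB : x ∈ B) :
    A = B := by
  have key : ∀ {A B : Set unitInterval}, IsOrbital Γ A → IsOrbital Γ B → x ∈ A → x ∈ B →
      A ⊆ B := by
    intro A B hA hB hxA hxB y hy
    obtain ⟨g, hg, hAg⟩ := hA
    rw [hAg.eq_orbitHull hxA] at hy
    obtain ⟨m, n, hm, hn⟩ := mem_orbitHull.1 hy
    have hz : ∀ k : ℤ, (g ^ k) x ∈ B := fun k => by
      rw [← inv B hB _ (Γ.zpow_mem hg k)]; exact ⟨x, hxB, rfl⟩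
    exact hB.choose_spec.2.ordConnected.out (hz m) (hz n) ⟨hm, hn⟩
  exact (key hA hB hxA hxB).antisymm (key hB hA hxB hxA)

/-- If `k` does not move down some point of the orbit hull of `y`, it does not move down `y`. -/
theorem le_apply_of_mem_orbitHull {k : HomeoI} {x y : unitInterval} (hx : x ≤ k x)
    (hxy : x ∈ orbitHull k y) : y ≤ k y := by
  by_contra! hy
  have hmono : Monotone fun n : ℤ => (k ^ n) x := monotone_int_of_le_succ fun n => by
    rw [zpow_add_one, mul_apply]; exact (k ^ n).monotone hx
  have hanti : StrictAnti fun n : ℤ => (k ^ n) y := strictAnti_int_of_succ_lt fun n => by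
    rw [zpow_add_one, mul_apply]; exact (k ^ n).strictMono hy
  obtain ⟨m, n, hm, hn⟩ := mem_orbitHull.1 hxy
  let p : ℤ := max (m - n + 1) 0
  have h1 : (k ^ (0 : ℤ)) x ≤ (k ^ p) x := hmono (le_max_right _ _)
  have h2 : (k ^ p) x ≤ (k ^ (p + n)) y := by
    rw [zpow_add_apply]; exact (k ^ p).monotone hn
  have h3 : (k ^ (p + n)) y < (k ^ m) y := hanti (by simp only [p]; omega)
  rw [zpow_zero, one_apply] at h1
  exact ((h1.trans h2).trans_lt h3).not_ge hm

/-- If every orbital of `Γ` is `Γ`-invariant then `Γ` is Abelian. -/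
theorem mul_comm_of_image_eq {Γ : Subgroup HomeoI}
    (inv : ∀ A, IsOrbital Γ A → ∀ g ∈ Γ, g '' A = A) {a b : HomeoI} (ha : a ∈ Γ)
    (hb : b ∈ Γ) : a * b = b * a := by
  by_contra hab
  obtain ⟨x, hx⟩ : ∃ x, (a * b) x ≠ (b * a) x := by
    by_contra! h
    exact hab (OrderIso.ext (funext h))
  obtain ⟨J, hJ, hxJ⟩ : ∃ J, IsOrbital Γ J ∧ x ∈ J := by
    refine ⟨orbitHull ((b * a)⁻¹ * (a * b)) x, ⟨_, ?_, isOrbitalOf_orbitHull fun h => hx ?_⟩,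
      self_mem_orbitHull _ _⟩
    · exact Γ.mul_mem (Γ.inv_mem (Γ.mul_mem hb ha)) (Γ.mul_mem ha hb)
    · have := congrArg (b * a) h
      rwa [mul_apply _⁻¹, apply_inv_self] at this
  have maps : ∀ g ∈ Γ, ∀ y ∈ J, g y ∈ J := fun g hg y hy => by
    rw [← inv J hJ g hg]; exact ⟨y, hy, rfl⟩
  have hull : ∀ g ∈ Γ, ∀ y ∈ J, g y ≠ y → orbitHull g y = J := fun g hg y hy hne =>
    IsOrbital.eq_of_mem inv ⟨g, hg, isOrbitalOf_orbitHull hne⟩ hJ (self_mem_orbitHull g y) hy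
  let : Preorder Γ := Preorder.lift fun g : Γ => (g : HomeoI) x
  have : MulLeftMono Γ := ⟨fun f g h hgh => (f : HomeoI).monotone hgh⟩
  have : MulRightMono Γ := ⟨fun f g h hgh => by
    change (g : HomeoI) ((f : HomeoI) x) ≤ (h : HomeoI) ((f : HomeoI) x)
    have hgh' : x ≤ ((g⁻¹ * h : Γ) : HomeoI) x := by
      rw [← (g : HomeoI).le_iff_le]
      change _ ≤ (g : HomeoI) ((g : HomeoI)⁻¹ ((h : HomeoI) x))
      rw [apply_inv_self]
      exact hgh
    have hy := maps f f.2 x hxJ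
    have : (f : HomeoI) x ≤ ((g⁻¹ * h : Γ) : HomeoI) ((f : HomeoI) x) := by
      by_contra hlt
      refine hlt (le_apply_of_mem_orbitHull hgh' ?_)
      rw [hull _ (g⁻¹ * h).2 _ hy fun h => hlt h.ge]
      exact hxJ
    have := (g : HomeoI).monotone this
    change _ ≤ (g : HomeoI) ((g : HomeoI)⁻¹ ((h : HomeoI) ((f : HomeoI) x))) at this
    rwa [apply_inv_self] at this⟩
  have arch : ∀ g : Γ, 1 < g → ∀ h : Γ, ∃ n : ℤ, h < g ^ n := by
    intro g hg h
    have hg' : x < (g : HomeoI) x := hg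
    have hmem : (h : HomeoI) x ∈ orbitHull (g : HomeoI) x := by
      rw [hull g g.2 x hxJ hg'.ne']
      exact maps h h.2 x hxJ
    obtain ⟨-, n, -, hn⟩ := mem_orbitHull.1 hmem
    refine ⟨n + 1, ?_⟩
    change (h : HomeoI) x < ((g ^ (n + 1) : Γ) : HomeoI) x
    rw [Subgroup.coe_zpow, zpow_add_apply, zpow_one]
    exact hn.trans_lt (((g : HomeoI) ^ n).strictMono hg')
  have comm := mul_le_mul_swap_of_archimedean (G := Γ) 
    (fun g h => le_total ((g : HomeoI) x) ((h : HomeoI) x)) arch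
  exact hx (le_antisymm (comm ⟨a, ha⟩ ⟨b, hb⟩) (comm ⟨b, hb⟩ ⟨a, ha⟩))

/-- A non-Abelian subgroup `Γ ≤ Homeo₊(I)` with `h(Γ) < ∞` possesses a maximal inner
orbital. -/
theorem exists_maximal_inner_orbital (Γ : Subgroup HomeoI)
    (hna : ¬ ∀ a ∈ Γ, ∀ b ∈ Γ, a * b = b * a)
    (hh : height Γ ≠ ⊤) :
    ∃ A, IsMaximalInnerOrbital Γ A := by
  obtain ⟨A₀, hA₀, hin₀⟩ : ∃ A, IsOrbital Γ A ∧ IsInner A := by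
    by_contra! h
    exact hna fun a ha b hb => mul_comm_of_image_eq (fun A hA g hg =>
      image_eq_of_comparable hh hA hg (image_subset_or_subset_of_not_isInner hA (h A hA) hg)) ha hb
  by_contra! hmax
  have next : ∀ A : {A // IsOrbital Γ A ∧ IsInner A},
      ∃ B : {A // IsOrbital Γ A ∧ IsInner A}, A.1 ⊂ B.1 := by
    rintro ⟨A, hA, hin⟩
    by_contra! h
    exact hmax A ⟨hA, hin, fun B hB hBin hAB =>
      by_contra fun hne => h ⟨B, hB, hBin⟩ (hAB.ssubset_of_ne hne)⟩
  choose s hs using next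
  let f : ℕ → {A // IsOrbital Γ A ∧ IsInner A} := fun n => s^[n] ⟨A₀, hA₀, hin₀⟩
  have mono : StrictMono fun n => (f n).1 := strictMono_nat_of_lt_succ fun n => by
    simp only [f, Function.iterate_succ_apply']
    exact hs _
  exact hh (height_eq_top_of_chain _ (fun n => (f n).2.1) mono.injective
    fun m n => (le_total m n).imp (fun h => mono.monotone h) (fun h => mono.monotone h))

end HeightHomeo
end

section
/- Let Γ ≤ Diff^ω₊(I) be an irreducible solvable subgroup. Then every non-identity element of Γ has at most one fixed point in the open interval (0,1). -/
open Set

namespace HeightHomeo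

/-- `f ∈ Diff^ω₊(I)`: `f` extends to a real-analytic map on a neighborhood of `[0,1]`
(being an order-automorphism of `[0,1]`, `f` is automatically strictly increasing and
fixes `0` and `1`). -/
def IsAnalytic (f : HomeoI) : Prop :=
  ∃ F : ℝ → ℝ, (∀ x ∈ Set.Icc (0 : ℝ) 1, AnalyticAt ℝ F x) ∧
    ∀ x : unitInterval, F x = (f x : ℝ)

open Filter Topology

theorem deriv_nonneg_of_monotoneOn_Icc {f : ℝ → ℝ} (hf : AnalyticOnNhd ℝ f (Icc 0 1))
    (hmono : MonotoneOn f (Icc 0 1)) {x : ℝ} (hx : x ∈ Icc (0 : ℝ) 1) : 0 ≤ deriv f x := by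
  rw [← (hf x hx).differentiableAt.derivWithin (uniqueDiffOn_Icc zero_lt_one x hx)]
  exact hmono.derivWithin_nonneg

theorem deriv_pos_of_leftInvOn_Icc {f g : ℝ → ℝ} (hf : AnalyticOnNhd ℝ f (Icc 0 1))
    (hg : AnalyticOnNhd ℝ g (Icc 0 1)) (hmono : MonotoneOn f (Icc 0 1))
    (hmap : MapsTo f (Icc 0 1) (Icc 0 1)) (hgf : LeftInvOn g f (Icc 0 1)) {x : ℝ}
    (hx : x ∈ Icc (0 : ℝ) 1) : 0 < deriv f x := by
  refine (deriv_nonneg_of_monotoneOn_Icc hf hmono hx).lt_of_ne' fun h0 => ?_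
  have hcomp : HasDerivWithinAt (g ∘ f) (deriv g (f x) * deriv f x) (Icc 0 1) x :=
    ((hg _ (hmap hx)).differentiableAt.hasDerivAt.comp x
      (hf x hx).differentiableAt.hasDerivAt).hasDerivWithinAt
  have hid : HasDerivWithinAt (g ∘ f) 1 (Icc 0 1) x :=
    (hasDerivWithinAt_id x (Icc (0 : ℝ) 1)).congr (fun y hy => hgf hy) (hgf hx)
  have := (uniqueDiffOn_Icc zero_lt_one x hx).eq_deriv _ hcomp hid
  simp [h0] at this

theorem deriv_le_deriv_of_le_right {u v : ℝ → ℝ} {x y : ℝ} (hxy : x < y)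
    (hu : DifferentiableAt ℝ u x) (hv : DifferentiableAt ℝ v x) (heq : u x = v x)
    (hle : ∀ z ∈ Ioo x y, u z ≤ v z) : deriv u x ≤ deriv v x := by
  have hu' := (hasDerivWithinAt_iff_tendsto_slope' (s := Ioi x) self_notMem_Ioi).1
    hu.hasDerivAt.hasDerivWithinAt
  have hv' := (hasDerivWithinAt_iff_tendsto_slope' (s := Ioi x) self_notMem_Ioi).1
    hv.hasDerivAt.hasDerivWithinAt
  refine le_of_tendsto_of_tendsto hu' hv' ?_
  filter_upwards [Ioo_mem_nhdsGT hxy] with z hz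
  rw [slope_def_field, slope_def_field, heq]
  have := hle z hz
  have : 0 < z - x := sub_pos.2 hz.1
  gcongr

/-- **Bounded distortion.** A map lying between a contraction `h` and the identity and commuting
with `h` has derivative bounded below by a constant depending only on `h`. -/
theorem exists_lower_bound_deriv_of_commute {h : ℝ → ℝ} (hh : AnalyticOnNhd ℝ h (Icc 0 1))
    (hmap : MapsTo h (Ioo 0 1) (Ioo 0 1)) (h0 : h 0 = 0)
    (hpos : ∀ x ∈ Icc (0 : ℝ) 1, 0 < deriv h x)
    (hlim : ∀ x ∈ Ioo (0 : ℝ) 1, Tendsto (fun n => h^[n] x) atTop (𝓝 0)) :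
    ∃ c > 0, ∀ f : ℝ → ℝ, AnalyticOnNhd ℝ f (Icc 0 1) → MonotoneOn f (Icc 0 1) →
      (∀ x ∈ Icc (0 : ℝ) 1, h x ≤ f x ∧ f x ≤ x) → (∀ x ∈ Ioo (0 : ℝ) 1, f (h x) = h (f x)) →
      ∀ x ∈ Ioo (0 : ℝ) 1, c ≤ deriv f x := by
  have hmem0 : (0 : ℝ) ∈ Icc (0 : ℝ) 1 := ⟨le_rfl, zero_le_one⟩
  have hlog : ContDiffOn ℝ 1 (fun x => Real.log (deriv h x)) (Icc 0 1) :=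
    (hh.deriv.contDiffOn (uniqueDiffOn_Icc zero_lt_one)).log fun x hx => (hpos x hx).ne'
  obtain ⟨L, hL⟩ :=
    hlog.exists_lipschitzOnWith one_ne_zero (convex_Icc 0 1) isCompact_Icc
  refine ⟨deriv h 0 * Real.exp (-L), mul_pos (hpos 0 hmem0) (Real.exp_pos _), ?_⟩
  intro f hf hmono hbd hcomm x hx
  have hf0 : f 0 = 0 := le_antisymm (hbd 0 hmem0).2 (h0.ge.trans (hbd 0 hmem0).1)
  have step : ∀ y ∈ Ioo (0 : ℝ) 1,
      deriv f (h y) * Real.exp (-L * (y - h y)) ≤ deriv f y := by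
    intro y hy
    have hyI := Ioo_subset_Icc_self hy
    have hhyI := Ioo_subset_Icc_self (hmap hy)
    have hfy : f y ∈ Icc (0 : ℝ) 1 :=
      ⟨hhyI.1.trans (hbd y hyI).1, (hbd y hyI).2.trans hyI.2⟩
    have e1 := ((hf _ hhyI).differentiableAt.hasDerivAt.comp y
      (hh y hyI).differentiableAt.hasDerivAt)
    have e2 := ((hh _ hfy).differentiableAt.hasDerivAt.comp y
      (hf y hyI).differentiableAt.hasDerivAt)
    have hev : f ∘ h =ᶠ[𝓝 y] h ∘ f := by
      filter_upwards [isOpen_Ioo.mem_nhds hy] with z hz using hcomm z hz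
    have heq := e1.unique (e2.congr_of_eventuallyEq hev)
    have hlip := hL.dist_le_mul _ hfy _ hyI
    rw [Real.dist_eq, Real.dist_eq] at hlip
    have hlip2 : Real.log (deriv h (f y)) - Real.log (deriv h y) ≤ L * (y - h y) := by
      refine (le_abs_self _).trans (hlip.trans ?_)
      rw [abs_sub_comm, abs_of_nonneg (sub_nonneg.2 (hbd y hyI).2)]
      have := (hbd y hyI).1
      gcongr
    have hexp : deriv h (f y) * Real.exp (-L * (y - h y)) ≤ deriv h y := by
      rw [← Real.exp_log (hpos _ hfy), ← Real.exp_add]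
      refine (Real.le_log_iff_exp_le (hpos _ hyI)).1 ?_
      linarith
    have hnn := deriv_nonneg_of_monotoneOn_Icc hf hmono hhyI
    refine le_of_mul_le_mul_left ?_ (hpos _ hfy)
    rw [← heq]
    calc _ = deriv f (h y) * (deriv h (f y) * Real.exp (-L * (y - h y))) := by ring
      _ ≤ _ := by gcongr
  have hiter : ∀ n : ℕ, h^[n] x ∈ Ioo (0 : ℝ) 1 := fun n => hmap.iterate n hx
  have hn : ∀ n : ℕ, deriv f (h^[n] x) * Real.exp (-L * (x - h^[n] x)) ≤ deriv f x := by
    intro n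
    induction n with
    | zero => simp
    | succ n ih =>
      refine le_trans ?_ ih
      rw [Function.iterate_succ_apply']
      calc _ = deriv f (h (h^[n] x)) * Real.exp (-L * (h^[n] x - h (h^[n] x))) *
            Real.exp (-L * (x - h^[n] x)) := by
            rw [mul_assoc, ← Real.exp_add]; congr 2; ring
        _ ≤ _ := by gcongr; exact step _ (hiter n)
  have ht : Tendsto (fun n => deriv f (h^[n] x) * Real.exp (-L * (x - h^[n] x))) atTop
      (𝓝 (deriv f 0 * Real.exp (-L * (x - 0)))) :=
    ((hf.deriv 0 hmem0).continuousAt.tendsto.comp (hlim x hx)).mul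
      ((Real.continuous_exp.tendsto _).comp (((hlim x hx).const_sub x).const_mul _))
  refine le_trans ?_ (le_of_tendsto' ht hn)
  have hd : deriv h 0 ≤ deriv f 0 :=
    deriv_le_deriv_of_le_right zero_lt_one (hh 0 hmem0).differentiableAt
      (hf 0 hmem0).differentiableAt (h0.trans hf0.symm)
      fun z hz => (hbd z (Ioo_subset_Icc_self hz)).1
  have hpos0 := hpos 0 hmem0
  have hLx : -(L : ℝ) ≤ -L * (x - 0) := by
    have := mul_le_mul_of_nonneg_left hx.2.le L.2
    simp only [NNReal.val_eq_coe] at this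
    linarith
  have hf0' : 0 ≤ deriv f 0 := hpos0.le.trans hd
  gcongr

theorem homeoI_pow_apply (f : HomeoI) (n : ℕ) (x : unitInterval) :
    (f ^ n) x = f^[n] x := by
  induction n with
  | zero => rfl
  | succ n ih => rw [pow_succ', Function.iterate_succ_apply', ← ih]; rfl

theorem exists_iterate_lt {f : HomeoI} (hf : ∀ x, 0 < x → x < 1 → f x < x) {y z : unitInterval}
    (hy : y < 1) (hz : 0 < z) : ∃ n : ℕ, f^[n] y < z := by
  by_contra! hcon
  have hle : z ≤ ⨅ n : ℕ, f^[n] y := le_iInf hcon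
  have hlt : (⨅ n : ℕ, f^[n] y) < 1 := (iInf_le _ 0).trans_lt hy
  refine (hf _ (hz.trans_le hle) hlt).not_ge ?_
  rw [OrderIso.map_iInf]
  refine le_iInf fun n => ?_
  rw [← Function.iterate_succ_apply' (f := f)]
  exact iInf_le _ (n + 1)

theorem apply_lt_of_fixedPointFree {f : HomeoI} (hf : ∀ x, 0 < x → x < 1 → f x ≠ x)
    {p : unitInterval} (hp0 : 0 < p) (hp1 : p < 1) (hp : f p < p) (x : unitInterval)
    (hx0 : 0 < x) (hx1 : x < 1) : f x < x := by
  by_contra! hx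
  obtain ⟨c, hc, hcc⟩ := isPreconnected_Ioo.intermediate_value₂ (s := Ioo (0 : unitInterval) 1)
    ⟨hp0, hp1⟩ ⟨hx0, hx1⟩ f.continuous.continuousOn continuousOn_id hp.le hx
  exact hf c hc.1 hc.2 hcc

theorem fixed_of_mapsTo_finite {f : HomeoI} {S : Set unitInterval} (hS : S.Finite)
    (hf : MapsTo f S S) {x : unitInterval} (hx : x ∈ S) : f x = x := by
  have hmem : ∀ n : ℕ, f^[n] x ∈ S := fun n => hf.iterate n hx
  have hninj : ¬ Function.Injective fun n : ℕ => f^[n] x := fun hinj =>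
    Set.infinite_of_injective_forall_mem hinj hmem hS
  rcases lt_trichotomy (f x) x with h | h | h
  · exact (hninj (f.strictMono.strictAnti_iterate_of_map_lt h).injective).elim
  · exact h
  · exact (hninj (f.strictMono.strictMono_iterate_of_lt_map h).injective).elim

theorem finite_fixedPoints {f : HomeoI} (hf : IsAnalytic f) (hne : f ≠ 1) :
    {x | f x = x}.Finite := by
  by_contra hinf
  obtain ⟨F, hF, hFf⟩ := hf
  have hinf' : ((↑) '' {x | f x = x} : Set ℝ).Infinite :=
    Set.Infinite.image Subtype.val_injective.injOn hinf
  have hsub : ((↑) '' {x | f x = x} : Set ℝ) ⊆ Icc 0 1 := by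
    rintro _ ⟨x, -, rfl⟩; exact x.2
  obtain ⟨z, hz, hacc⟩ := hinf'.exists_accPt_of_subset_isCompact isCompact_Icc hsub
  have hfreq : ∃ᶠ y in 𝓝[≠] z, F y = id y := by
    refine (accPt_iff_frequently_nhdsNE.1 hacc).mono ?_
    rintro _ ⟨x, hx, rfl⟩
    rw [hFf, id]
    exact congrArg _ hx
  have heq := AnalyticOnNhd.eqOn_of_preconnected_of_frequently_eq hF
    (fun x _ => analyticAt_id) isPreconnected_Icc hz hfreq
  refine hne (DFunLike.ext _ _ fun x => Subtype.ext ?_)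
  rw [← hFf x]
  exact heq x.2

theorem exists_normal_commutative_of_solvable (G : Type*) [Group G] [Nontrivial G]
    (hG : Group.IsSolvable G) :
    ∃ N : Subgroup G, N.Normal ∧ N ≠ ⊥ ∧ ∀ a ∈ N, ∀ b ∈ N, a * b = b * a := by
  classical
  have hex : ∃ n, derivedSeries G n = ⊥ := hG.solvable
  have hne : Nat.find hex ≠ 0 := by
    intro h0
    have := Nat.find_spec hex
    rw [h0, derivedSeries_zero] at this
    exact top_ne_bot this
  obtain ⟨m, hm⟩ := Nat.exists_eq_succ_of_ne_zero hne
  refine ⟨derivedSeries G m, inferInstance, Nat.find_min hex (by omega), fun a ha b hb => ?_⟩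
  have hbot := Nat.find_spec hex
  rw [hm, derivedSeries_succ, Subgroup.commutator_eq_bot_iff_le_centralizer] at hbot
  exact (Subgroup.mem_centralizer_iff.1 (hbot ha) b hb).symm

theorem mem_Ioo_coe_iff {x : unitInterval} : (x : ℝ) ∈ Ioo (0 : ℝ) 1 ↔ 0 < x ∧ x < 1 := Iff.rfl

theorem monotoneOn_of_extends {f : HomeoI} {F : ℝ → ℝ} (hF : ∀ x : unitInterval, F x = (f x : ℝ)) :
    MonotoneOn F (Icc 0 1) := by
  intro x hx y hy hxy
  rw [hF ⟨x, hx⟩, hF ⟨y, hy⟩]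
  exact f.monotone (show (⟨x, hx⟩ : unitInterval) ≤ ⟨y, hy⟩ from hxy)

theorem homeoI_apply_zero (f : HomeoI) : f 0 = 0 := f.map_bot

theorem homeoI_apply_one (f : HomeoI) : f 1 = 1 := f.map_top

theorem mul_homeoI_apply (f g : HomeoI) (x : unitInterval) : (f * g) x = f (g x) := rfl

theorem inv_homeoI_apply_self (f : HomeoI) (x : unitInterval) : f⁻¹ (f x) = x :=
  f.symm_apply_apply x

theorem homeoI_apply_inv_self (f : HomeoI) (x : unitInterval) : f (f⁻¹ x) = x :=
  f.apply_symm_apply x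

theorem exists_lower_bound_length_of_commute {h : HomeoI} (hh : IsAnalytic h)
    (hh' : IsAnalytic h⁻¹) (hlt : ∀ x, 0 < x → x < 1 → h x < x) {p q : unitInterval}
    (hpq : p < q) :
    ∃ c > 0, ∀ f : HomeoI, IsAnalytic f → (∀ x, h x ≤ f x ∧ f x ≤ x) → f * h = h * f →
      c ≤ (f q : ℝ) - f p := by
  obtain ⟨F, hF, hFh⟩ := hh
  obtain ⟨G, hG, hGh⟩ := hh'
  have hmapIcc : MapsTo F (Icc 0 1) (Icc 0 1) := fun x hx => by
    rw [hFh ⟨x, hx⟩]; exact (h ⟨x, hx⟩).2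
  have hmap : MapsTo F (Ioo 0 1) (Ioo 0 1) := fun x hx => by
    rw [hFh ⟨x, Ioo_subset_Icc_self hx⟩, mem_Ioo_coe_iff]
    constructor
    · rw [← homeoI_apply_zero h]
      exact h.strictMono hx.1
    · rw [← homeoI_apply_one h]
      exact h.strictMono hx.2
  have hinv : LeftInvOn G F (Icc 0 1) := fun x hx => by
    rw [hFh ⟨x, hx⟩, hGh, inv_homeoI_apply_self]
  have h0 : F 0 = 0 := by
    have := hFh 0
    rwa [homeoI_apply_zero] at this
  have hiter : ∀ (n : ℕ) (x : unitInterval), F^[n] x = (h^[n] x : ℝ) := by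
    intro n x
    induction n with
    | zero => rfl
    | succ n ih => rw [Function.iterate_succ_apply', Function.iterate_succ_apply', ih, hFh]
  have hlim : ∀ x ∈ Ioo (0 : ℝ) 1, Tendsto (fun n => F^[n] x) atTop (𝓝 0) := by
    intro x hx
    lift x to unitInterval using Ioo_subset_Icc_self hx
    simp only [hiter]
    rw [mem_Ioo_coe_iff] at hx
    have hanti := (h.strictMono.strictAnti_iterate_of_map_lt (hlt x hx.1 hx.2)).antitone
    refine tendsto_order.2 ⟨fun a ha => .of_forall fun n => ha.trans_le (h^[n] x).2.1,
      fun a ha => ?_⟩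
    by_cases ha1 : a ≤ 1
    · obtain ⟨n, hn⟩ := exists_iterate_lt hlt hx.2 (z := ⟨a, ha.le, ha1⟩) ha
      filter_upwards [eventually_ge_atTop n] with m hm
      exact lt_of_le_of_lt (hanti hm) hn
    · exact .of_forall fun n => (h^[n] x).2.2.trans_lt (not_le.1 ha1)
  obtain ⟨c, hc, hcf⟩ := exists_lower_bound_deriv_of_commute hF hmap h0
    (fun x hx => deriv_pos_of_leftInvOn_Icc hF hG (monotoneOn_of_extends hFh) hmapIcc hinv hx) hlim
  refine ⟨c * (q - p), mul_pos hc (sub_pos.2 hpq), ?_⟩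
  rintro f ⟨E, hE, hEf⟩ hbd hcomm
  replace hE : AnalyticOnNhd ℝ E (Icc 0 1) := hE
  have hder := hcf E hE (monotoneOn_of_extends hEf)
    (fun x hx => by
      lift x to unitInterval using hx
      rw [hEf, hFh]
      exact hbd x)
    (fun x hx => by
      lift x to unitInterval using Ioo_subset_Icc_self hx
      rw [hEf, hFh, hEf, hFh]
      exact congrArg Subtype.val (DFunLike.congr_fun hcomm x))
  have := (convex_Icc (0 : ℝ) 1).mul_sub_le_image_sub_of_le_deriv hE.continuousOn
    (hE.differentiableOn.mono interior_subset) (by rwa [interior_Icc]) p p.2 q q.2 hpq.le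
  rwa [hEf, hEf] at this

theorem homeoI_pow_lt {h : HomeoI} {p : unitInterval} (hp : h p < p) {k : ℕ} (hk : k ≠ 0) :
    (h ^ k) p < p := by
  rw [homeoI_pow_apply]
  exact h.strictMono.strictAnti_iterate_of_map_lt hp (Nat.pos_of_ne_zero hk)

/-- If `N` is an abelian group of analytic diffeomorphisms acting freely on `(0,1)`, a
homeomorphism normalizing `N` and conjugating a contraction in `N` to a weaker one has at most
one fixed point in `(0,1)`. -/
theorem not_fixed_of_lt_conj {N : Subgroup HomeoI} (hω : ∀ f ∈ N, IsAnalytic f)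
    (hcomm : ∀ a ∈ N, ∀ b ∈ N, a * b = b * a)
    (hfree : ∀ a ∈ N, a ≠ 1 → ∀ x, 0 < x → x < 1 → a x ≠ x)
    {g : HomeoI} (hg : ∀ a ∈ N, g * a * g⁻¹ ∈ N) {p q : unitInterval} (hp : 0 < p) (hpq : p < q)
    (hq : q < 1) (hgp : g p = p) {h : HomeoI} (hN : h ∈ N) (hhp : h p < p)
    (hconj : h p < g (h p)) : g q ≠ q := by
  intro hgq
  have hp1 := hpq.trans hq
  have hcontr : ∀ a ∈ N, a p < p → ∀ x, 0 < x → x < 1 → a x < x := fun a ha hap =>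
    apply_lt_of_fixedPointFree
      (hfree a ha (by rintro rfl; exact hap.ne rfl)) hp hp1 hap
  have hinvp : ∀ n : ℕ, (g ^ n) p = p := fun n => by
    rw [homeoI_pow_apply]; exact Function.iterate_fixed hgp n
  have hinvq : ∀ n : ℕ, (g ^ n) q = q := fun n => by
    rw [homeoI_pow_apply]; exact Function.iterate_fixed hgq n
  have hconjp : ∀ (n : ℕ) (a : HomeoI), (g ^ n * a * (g ^ n)⁻¹) p = (g ^ n) (a p) := fun n a => by
    rw [mul_homeoI_apply, mul_homeoI_apply]
    nth_rw 1 [← hinvp n]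
    rw [inv_homeoI_apply_self]
  have hconjq : ∀ (n : ℕ) (a : HomeoI), (g ^ n * a * (g ^ n)⁻¹) q = (g ^ n) (a q) := fun n a => by
    rw [mul_homeoI_apply, mul_homeoI_apply]
    nth_rw 1 [← hinvq n]
    rw [inv_homeoI_apply_self]
  have hconjN : ∀ (n : ℕ), ∀ a ∈ N, g ^ n * a * (g ^ n)⁻¹ ∈ N := by
    intro n a ha
    induction n with
    | zero => simpa using ha
    | succ n ih =>
      have := hg _ ih
      rw [pow_succ']
      convert this using 1
      group
  obtain ⟨k, hk0, hk⟩ : ∃ k : ℕ, k ≠ 0 ∧ (h ^ k) q < g ((h ^ k) p) := by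
    have hlt : ((g * h * g⁻¹)⁻¹ * h) p < p := by
      rw [mul_homeoI_apply, ← (g * h * g⁻¹).lt_iff_lt, homeoI_apply_inv_self]
      have := hconjp 1 h
      rw [pow_one] at this
      rwa [this]
    obtain ⟨k, hk⟩ := exists_iterate_lt
      (hcontr _ (N.mul_mem (N.inv_mem (hg h hN)) hN) hlt) hq hp
    refine ⟨k, ?_, ?_⟩
    · rintro rfl
      exact hpq.not_gt hk
    · have hc : Commute (g * h * g⁻¹)⁻¹ h := hcomm _ (N.inv_mem (hg h hN)) _ hN
      rw [← homeoI_pow_apply, hc.mul_pow, inv_pow, conj_pow, mul_homeoI_apply,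
        ← (g * h ^ k * g⁻¹).lt_iff_lt, homeoI_apply_inv_self] at hk
      have := hconjp 1 (h ^ k)
      rw [pow_one] at this
      rwa [this] at hk
  set H := h ^ k with hH
  have hHN : H ∈ N := N.pow_mem hN k
  have hHlt := hcontr H hHN (homeoI_pow_lt hhp hk0)
  have hHle : ∀ x, H x ≤ x := by
    intro x
    rcases eq_or_lt_of_le (show 0 ≤ x from x.2.1) with rfl | h0
    · exact (homeoI_apply_zero H).le
    rcases eq_or_lt_of_le (show x ≤ 1 from x.2.2) with rfl | h1
    · exact (homeoI_apply_one H).le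
    exact (hHlt x h0 h1).le
  obtain ⟨c, hc, hbound⟩ := exists_lower_bound_length_of_commute (hω H hHN)
    (hω _ (N.inv_mem hHN)) hHlt hpq
  have hlow : ∀ n : ℕ, H p ≤ (g ^ n) (H p) := fun n => by
    rw [homeoI_pow_apply g]
    exact (g.strictMono.strictMono_iterate_of_lt_map
      ((H.strictMono hpq).trans hk)).monotone n.zero_le
  have hsandwich : ∀ (n : ℕ) (x : unitInterval),
      H x ≤ (g ^ n * H * (g ^ n)⁻¹) x ∧ (g ^ n * H * (g ^ n)⁻¹) x ≤ x := by
    intro n x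
    constructor
    · set f := g ^ n * H * (g ^ n)⁻¹ with hf
      have hfN : f ∈ N := hconjN n H hHN
      rcases eq_or_lt_of_le (show 0 ≤ x from x.2.1) with rfl | h0
      · rw [homeoI_apply_zero, homeoI_apply_zero]
      rcases eq_or_lt_of_le (show x ≤ 1 from x.2.2) with rfl | h1
      · rw [homeoI_apply_one, homeoI_apply_one]
      by_cases hfH : f⁻¹ * H = 1
      · rw [inv_mul_eq_one.1 hfH]
      have hDN := N.mul_mem (N.inv_mem hfN) hHN
      have hle : (f⁻¹ * H) p ≤ p := by
        rw [mul_homeoI_apply, ← f.le_iff_le, homeoI_apply_inv_self, hf, hconjp]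
        exact hlow n
      have := hcontr _ hDN (hle.lt_of_ne (hfree _ hDN hfH p hp hp1)) x h0 h1
      rw [mul_homeoI_apply, ← f.lt_iff_lt, homeoI_apply_inv_self] at this
      exact this.le
    · rw [mul_homeoI_apply, mul_homeoI_apply]
      conv_rhs => rw [← homeoI_apply_inv_self (g ^ n) x]
      exact (g ^ n).monotone (hHle _)
  have hlen : ∀ n : ℕ, c ≤ ((g ^ n) (H q) : ℝ) - (g ^ n) (H p) := fun n => by
    have := hbound _ (hω _ (hconjN n H hHN)) (hsandwich n) (hcomm _ (hconjN n H hHN) _ hHN)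
    rwa [hconjp, hconjq] at this
  have hgrow : ∀ n : ℕ, n * c ≤ ((g ^ n) (H p) : ℝ) := by
    intro n
    induction n with
    | zero => rw [Nat.cast_zero, zero_mul]; exact ((g ^ 0) (H p)).2.1
    | succ n ih =>
      have hstep : ((g ^ n) (H q) : ℝ) ≤ (g ^ (n + 1)) (H p) := by
        rw [pow_succ]
        exact ((g ^ n).strictMono hk).le
      have := hlen n
      push_cast
      linarith
  obtain ⟨n, hn⟩ := exists_nat_gt (1 / c)
  rw [div_lt_iff₀ hc] at hn
  exact absurd (hgrow n) (not_le.2 (((g ^ n) (H p)).2.2.trans_lt hn))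

theorem not_fixed_of_normal_abelian {Γ N : Subgroup HomeoI} (hω : ∀ f ∈ Γ, IsAnalytic f)
    (hNΓ : N ≤ Γ) (hnormal : ∀ g ∈ Γ, ∀ a ∈ N, g * a * g⁻¹ ∈ N)
    (hcomm : ∀ a ∈ N, ∀ b ∈ N, a * b = b * a)
    (hfree : ∀ a ∈ N, a ≠ 1 → ∀ x, 0 < x → x < 1 → a x ≠ x) {a : HomeoI} (ha : a ∈ N)
    (ha1 : a ≠ 1) {g : HomeoI} (hg : g ∈ Γ) (hg1 : g ≠ 1) {p q : unitInterval} (hp : 0 < p)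
    (hpq : p < q) (hq : q < 1) (hgp : g p = p) : g q ≠ q := by
  intro hgq
  have hp1 := hpq.trans hq
  have hinv : ∀ {f : HomeoI} {x}, f x = x → f⁻¹ x = x := fun {f x} hx => by
    nth_rw 1 [← hx]
    exact inv_homeoI_apply_self f x
  obtain ⟨h, hN, hhp⟩ : ∃ h ∈ N, h p < p := by
    rcases lt_or_gt_of_ne (hfree a ha ha1 p hp hp1) with h | h
    · exact ⟨a, ha, h⟩
    · refine ⟨a⁻¹, N.inv_mem ha, ?_⟩
      rw [← a.lt_iff_lt, homeoI_apply_inv_self]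
      exact h
  have hconj : (g * h * g⁻¹) p = g (h p) := by
    rw [mul_homeoI_apply, mul_homeoI_apply, hinv hgp]
  rcases lt_trichotomy (h p) (g (h p)) with hlt | heq | hgt
  · exact not_fixed_of_lt_conj (fun f hf => hω f (hNΓ hf)) hcomm hfree (hnormal g hg) hp hpq hq
      hgp hN hhp hlt hgq
  · have h1 : (g * h * g⁻¹)⁻¹ * h = 1 := by
      by_contra hne
      refine hfree _ (N.mul_mem (N.inv_mem (hnormal g hg h hN)) hN) hne p hp hp1 ?_
      rw [mul_homeoI_apply, heq, ← hconj, inv_homeoI_apply_self]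
    have hgh : g * h = h * g := by
      rw [inv_mul_eq_one, mul_inv_eq_iff_eq_mul] at h1
      exact h1
    have hfix : ∀ n : ℕ, g (h^[n] p) = h^[n] p := fun n => by
      induction n with
      | zero => exact hgp
      | succ n ih =>
        rw [Function.iterate_succ_apply', ← mul_homeoI_apply, hgh, mul_homeoI_apply, ih]
    exact Set.infinite_of_injective_forall_mem
      (h.strictMono.strictAnti_iterate_of_map_lt hhp).injective hfix
      (finite_fixedPoints (hω g hg) hg1)
  · refine not_fixed_of_lt_conj (g := g⁻¹) (fun f hf => hω f (hNΓ hf)) hcomm hfree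
      (hnormal _ (Γ.inv_mem hg)) hp hpq hq (hinv hgp) hN hhp ?_ (hinv hgq)
    rw [← g.lt_iff_lt, homeoI_apply_inv_self]
    exact hgt

theorem free_of_normal_abelian {Γ N : Subgroup HomeoI} (hω : ∀ f ∈ Γ, IsAnalytic f)
    (hirr : ∀ x : unitInterval, 0 < (x : ℝ) → (x : ℝ) < 1 → ∃ g ∈ Γ, g x ≠ x)
    (hNΓ : N ≤ Γ) (hnormal : ∀ g ∈ Γ, ∀ a ∈ N, g * a * g⁻¹ ∈ N)
    (hcomm : ∀ a ∈ N, ∀ b ∈ N, a * b = b * a) {a : HomeoI} (ha : a ∈ N) (ha1 : a ≠ 1)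
    (x : unitInterval) (hx0 : 0 < x) (hx1 : x < 1) : a x ≠ x := by
  intro hax
  have hfin := finite_fixedPoints (hω a (hNΓ ha)) ha1
  have hN : ∀ b ∈ N, ∀ y, a y = y → b y = y := fun b hb y hy =>
    fixed_of_mapsTo_finite hfin (fun z (hz : a z = z) => show a (b z) = b z by
      rw [← mul_homeoI_apply, hcomm a ha b hb, mul_homeoI_apply, hz]) hy
  obtain ⟨g, hg, hgx⟩ := hirr x hx0 hx1
  refine hgx (fixed_of_mapsTo_finite hfin (fun z (hz : a z = z) => show a (g z) = g z from ?_) hax)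
  have := hN _ (hnormal _ (Γ.inv_mem hg) a ha) z hz
  rw [inv_inv, mul_homeoI_apply, mul_homeoI_apply, ← g.apply_eq_iff_eq, homeoI_apply_inv_self]
    at this
  exact this

/-- Every non-identity element of an irreducible solvable subgroup of `Diff^ω₊(I)`
has at most one fixed point in `(0,1)`. -/
theorem solvable_irreducible_at_most_one_fixed_point (Γ : Subgroup HomeoI)
    (hω : ∀ f ∈ Γ, IsAnalytic f)
    (hirr : ∀ x : unitInterval, 0 < (x : ℝ) → (x : ℝ) < 1 → ∃ g ∈ Γ, g x ≠ x)
    (hsol : IsSolvable ↥Γ) :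
    ∀ g ∈ Γ, g ≠ 1 →
      {x : unitInterval | 0 < (x : ℝ) ∧ (x : ℝ) < 1 ∧ g x = x}.Subsingleton := by
  intro g hg hg1 p hp q hq
  obtain ⟨b, hb, hb1⟩ := hirr ⟨1 / 2, by norm_num, by norm_num⟩ (by norm_num) (by norm_num)
  have : Nontrivial Γ := ⟨⟨⟨b, hb⟩, 1, fun h => hb1 (DFunLike.congr_fun (congrArg Subtype.val h) _)⟩⟩
  obtain ⟨M, hM, hM1, hMc⟩ := exists_normal_commutative_of_solvable Γ hsol
  obtain ⟨a, ha, ha1⟩ := M.bot_or_exists_ne_one.resolve_left hM1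
  have hNΓ : M.map Γ.subtype ≤ Γ := Subgroup.map_subtype_le M
  have hnormal : ∀ g ∈ Γ, ∀ a ∈ M.map Γ.subtype, g * a * g⁻¹ ∈ M.map Γ.subtype := by
    rintro g hg _ ⟨a, ha, rfl⟩
    exact ⟨⟨g, hg⟩ * a * ⟨g, hg⟩⁻¹, hM.conj_mem a ha _, rfl⟩
  have hcomm : ∀ a ∈ M.map Γ.subtype, ∀ b ∈ M.map Γ.subtype, a * b = b * a := by
    rintro _ ⟨a, ha, rfl⟩ _ ⟨b, hb, rfl⟩
    exact congrArg Subtype.val (hMc a ha b hb)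
  have key : ∀ {p q : unitInterval}, 0 < p → p < q → q < 1 → g p = p → g q ≠ q :=
    not_fixed_of_normal_abelian hω hNΓ hnormal hcomm
      (fun a ha ha1 => free_of_normal_abelian hω hirr hNΓ hnormal hcomm ha ha1)
      (Subgroup.mem_map_of_mem _ ha) (fun h => ha1 (Subtype.ext h)) hg hg1
  rcases lt_trichotomy p q with h | h | h
  · exact (key hp.1 h hq.2.1 hp.2.2 hq.2.2).elim
  · exact h
  · exact (key hq.1 h hp.2.1 hq.2.2 hp.2.2).elim

end HeightHomeo
end
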